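/- arXiv:math/9803068 — 6 statements merged into one kernel-verified Lean document; each statement's English description precedes it below -/
import Mathlib

section
/- Fix an integer r ≥ 1 and real numbers m and b with r ≥ -m. Suppose given abelian groups D^{s,t} and E^{s,t} for all integers s, t, together with group homomorphisms i : D^{s+1,t+1} → D^{s,t}, j : D^{s,t} → E^{s+r-1,t+r-1}, and k : E^{s,t} → D^{s+1,t}, such that the resulting long sequence ⋯ → E^{s,t+1} →(k) D^{s+1,t+1} →(i) D^{s,t} →(j) E^{s+r-1,t+r-1} →(k) D^{s+r,t+r-1} → ⋯ is exact at every term. If D^{s,t} = 0 for all integers s, t with s ≥ m(t−s) + b, then E^{s,t} = 0 for all integers s, t with s ≥ m(t−s) + b + r − 1. -/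
/-- Lemma 2(a), case `r ≥ -m`, of Hopkins–Palmieri–Smith:
if the derived-couple groups `D^{s,t}` vanish above the line `s = m(t-s) + b`,
then the `E`-groups vanish above the line `s = m(t-s) + b + r - 1`. -/
theorem vanishing_line_D_to_E_of_r_ge_neg_m
    (r : ℤ) (m b : ℝ) (hr : 1 ≤ r) (hrm : (r : ℝ) ≥ -m)
    (D E : ℤ → ℤ → Type*)
    [∀ s t, AddCommGroup (D s t)] [∀ s t, AddCommGroup (E s t)]
    (i : ∀ s t, D (s + 1) (t + 1) →+ D s t)
    (j : ∀ s t, D s t →+ E (s + r - 1) (t + r - 1))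
    (k : ∀ s t, E s t →+ D (s + 1) t)
    (hexD' : ∀ s t, Function.Exact (k s (t + 1)) (i s t))
    (hexD : ∀ s t, Function.Exact (i s t) (j s t))
    (hexE : ∀ s t, Function.Exact (j s t) (k (s + r - 1) (t + r - 1)))
    (hD : ∀ s t : ℤ, (s : ℝ) ≥ m * (t - s) + b → ∀ x : D s t, x = 0) :
    ∀ s t : ℤ, (s : ℝ) ≥ m * (t - s) + b + r - 1 → ∀ x : E s t, x = 0 := by
  intro s t hst
  obtain ⟨s, rfl⟩ : ∃ s', s = s' + r - 1 := ⟨s - r + 1, by ring⟩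
  obtain ⟨t, rfl⟩ : ∃ t', t = t' + r - 1 := ⟨t - r + 1, by ring⟩
  intro x
  push_cast at hst
  have hk : k (s + r - 1) (t + r - 1) x = 0 := by
    apply hD
    push_cast
    linarith
  obtain ⟨y, rfl⟩ := (hexE s t x).1 hk
  have hy : y = 0 := by
    apply hD
    linarith
  rw [hy, map_zero]
end

section
/- Fix an integer r ≥ 1 and real numbers m and b with r < -m. Suppose given abelian groups D^{s,t} and E^{s,t} for all integers s, t, together with group homomorphisms i : D^{s+1,t+1} → D^{s,t}, j : D^{s,t} → E^{s+r-1,t+r-1}, and k : E^{s,t} → D^{s+1,t}, such that the resulting long sequence ⋯ → E^{s,t+1} →(k) D^{s+1,t+1} →(i) D^{s,t} →(j) E^{s+r-1,t+r-1} →(k) D^{s+r,t+r-1} → ⋯ is exact at every term. If D^{s,t} = 0 for all integers s, t with s ≥ m(t−s) + b, then E^{s,t} = 0 for all integers s, t with s ≥ m(t−s) + b − m. -/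
/-- Lemma 2(a), case `r < -m`, of Hopkins–Palmieri–Smith:
if the derived-couple groups `D^{s,t}` vanish above the line `s = m(t-s) + b`,
then the `E`-groups vanish above the line `s = m(t-s) + b - m`. -/
theorem vanishing_line_D_to_E_of_r_lt_neg_m
    (r : ℤ) (m b : ℝ) (hr : 1 ≤ r) (hrm : (r : ℝ) < -m)
    (D E : ℤ → ℤ → Type*)
    [∀ s t, AddCommGroup (D s t)] [∀ s t, AddCommGroup (E s t)]
    (i : ∀ s t, D (s + 1) (t + 1) →+ D s t)
    (j : ∀ s t, D s t →+ E (s + r - 1) (t + r - 1))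
    (k : ∀ s t, E s t →+ D (s + 1) t)
    (hexD' : ∀ s t, Function.Exact (k s (t + 1)) (i s t))
    (hexD : ∀ s t, Function.Exact (i s t) (j s t))
    (hexE : ∀ s t, Function.Exact (j s t) (k (s + r - 1) (t + r - 1)))
    (hD : ∀ s t : ℤ, (s : ℝ) ≥ m * (t - s) + b → ∀ x : D s t, x = 0) :
    ∀ s t : ℤ, (s : ℝ) ≥ m * (t - s) + b - m → ∀ x : E s t, x = 0 := by
  intro s t hst x
  obtain ⟨s', rfl⟩ : ∃ s', s = s' + r - 1 := ⟨s - r + 1, by ring⟩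
  obtain ⟨t', rfl⟩ : ∃ t', t = t' + r - 1 := ⟨t - r + 1, by ring⟩
  push_cast at hst
  have hk : k (s' + r - 1) (t' + r - 1) x = 0 := by
    apply hD
    push_cast
    linarith
  obtain ⟨y, rfl⟩ := (hexE s' t' x).1 hk
  have hy : y = 0 := by
    apply hD
    linarith
  rw [hy, map_zero]
end

section
/- Fix an integer r ≥ 1 and real numbers m and b with r ≥ 1 − m. Suppose given: (i) for each integer n and each natural number q, an abelian group G_q^n with homomorphisms g : G_{q+1}^n → G_q^n, such that for each n the inverse limit of the tower (G_q^n, g) vanishes, i.e., any family of elements x_q ∈ G_q^n satisfying g(x_{q+1}) = x_q for all q must have every x_q = 0; (ii) for integers s ≥ 0 and t, set D^{s,t} := the image of the (r−1)-fold composite g^{r−1} : G_{s+r-1}^{t-s} → G_s^{t-s}, a subgroup of G_s^{t-s}, and note that g restricts to a homomorphism ḡ : D^{s+1,t+1} → D^{s,t}; (iii) abelian groups E^{s,t} with homomorphisms j : D^{s,t} → E^{s+r-1,t+r-1} and k : E^{s,t} → D^{s+1,t}, such that the long sequence ⋯ → E^{s,t+1} →(k) D^{s+1,t+1} →(ḡ)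 D^{s,t} →(j) E^{s+r-1,t+r-1} →(k) D^{s+r,t+r-1} → ⋯ is exact at every term. If E^{s,t} = 0 for all s, t with s ≥ m(t−s) + b, then the composite g^{r−1} : G_{s+r-1}^{t-s} → G_s^{t-s} is the zero homomorphism (equivalently D^{s,t} = 0) for all s, t with s ≥ m(t−s+1) + b. -/
/-- The `k`-fold composite `G (q+k) →+ G q` of the structure maps of a tower
of abelian groups. -/
def towerComp {G : ℕ → Type*} [∀ q, AddCommGroup (G q)]
    (g : ∀ q, G (q + 1) →+ G q) : ∀ (k q : ℕ), G (q + k) →+ G q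
  | 0, _ => AddMonoidHom.id _
  | k + 1, q => (towerComp g k q).comp (g (q + k))

theorem extend_down {G : ℕ → Type*} [∀ q, AddCommGroup (G q)]
    (g : ∀ q, G (q + 1) →+ G q) (s : ℕ) :
    ∀ y : ∀ q, G q, (∀ q, s ≤ q → g q (y (q + 1)) = y q) →
      ∃ x : ∀ q, G q, (∀ q, g q (x (q + 1)) = x q) ∧ ∀ q, s ≤ q → x q = y q := by
  induction s with
  | zero => exact fun y hy => ⟨y, fun q => hy q (Nat.zero_le q), fun _ _ => rfl⟩
  | succ s ih =>
    intro y hy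
    obtain ⟨x, hx, hxy⟩ := ih (fun q => if s + 1 ≤ q then y q else g q (y (q + 1))) (by
      intro q hq
      have h1 : s + 1 ≤ q + 1 := by omega
      simp only [if_pos h1]
      split_ifs with h
      · exact hy q h
      · rfl)
    refine ⟨x, hx, fun q hq => ?_⟩
    rw [hxy q (by omega), if_pos hq]

theorem exists_seq_from (A : ℕ → Type*) [∀ q, Zero (A q)]
    (sec : ∀ q, A q → A (q + 1)) (s : ℕ) (x0 : A s) :
    ∃ y : ∀ q, A q, y s = x0 ∧ ∀ q, s ≤ q → y (q + 1) = sec q (y q) := by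
  let y : ∀ q, A q := fun q => Nat.rec (motive := fun q => A q)
    (if h : s = 0 then cast (congrArg A h) x0 else 0)
    (fun q a => if h : s = q + 1 then cast (congrArg A h) x0 else sec q a) q
  refine ⟨y, ?_, fun q hq => ?_⟩
  · cases s with
    | zero => simp [y]
    | succ s => simp [y]
  · have h : ¬ s = q + 1 := by omega
    simp only [y, dif_neg h]

/-- Lemma 2(b), case `r ≥ 1 - m`, of Hopkins–Palmieri–Smith.
Here `G n q = π_n(F_q X)` are the homotopy groups of the Adams tower
(with vanishing inverse limit, from `E`-completeness),
`D n s` is the image of `g^{r-1} : G n (s+r-1) → G n s` (indexed so that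
`D n s = D_r^{s,t}` with `n = t - s`), `E n s = E_r^{s,t}`, and the long
sequence `⋯ → E^{s,t+1} → D^{s+1,t+1} → D^{s,t} → E^{s+r-1,t+r-1} → D^{s+r,t+r-1} → ⋯`
is exact.  If `E^{s,t} = 0` for `s ≥ m(t-s) + b`, then `g^{r-1}` is zero
(i.e. `D^{s,t} = 0`) for `s ≥ m(t-s+1) + b`. -/
theorem vanishing_line_E_to_D_of_r_ge_one_sub_m
    (r : ℕ) (m b : ℝ) (hr : 1 ≤ r) (hrm : (r : ℝ) ≥ 1 - m)
    (G : ℤ → ℕ → Type*) [∀ n q, AddCommGroup (G n q)]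
    (g : ∀ n q, G n (q + 1) →+ G n q)
    (hlim : ∀ (n : ℤ) (x : ∀ q, G n q),
      (∀ q, g n q (x (q + 1)) = x q) → ∀ q, x q = 0)
    (D : ∀ (n : ℤ) (q : ℕ), AddSubgroup (G n q))
    (hD : ∀ n q, D n q = (towerComp (g n) (r - 1) q).range)
    (E : ℤ → ℕ → Type*) [∀ n q, AddCommGroup (E n q)]
    (gbar : ∀ n q, D n (q + 1) →+ D n q)
    (hgbar : ∀ n q (x : D n (q + 1)), (gbar n q x : G n q) = g n q (x : G n (q + 1)))
    (j : ∀ n q, D n q →+ E n (q + (r - 1)))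
    (k : ∀ n q, E (n + 1) q →+ D n (q + 1))
    (hexD' : ∀ n q, Function.Exact (k n q) (gbar n q))
    (hexD : ∀ n q, Function.Exact (gbar n q) (j n q))
    (hexE : ∀ n q, Function.Exact (j (n + 1) q) (k n (q + (r - 1))))
    (hE : ∀ (n : ℤ) (s : ℕ), (s : ℝ) ≥ m * n + b → ∀ x : E n s, x = 0) :
    ∀ (n : ℤ) (s : ℕ), (s : ℝ) ≥ m * (n + 1) + b →
      towerComp (g n) (r - 1) s = 0 := by
  intro n s hs
  have hsurj : ∀ q, ∃ sec : D n q → D n (q + 1), s ≤ q → ∀ x, gbar n q (sec x) = x := by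
    intro q
    by_cases h : s ≤ q
    · have hz : ∀ x : D n q, ∃ y, gbar n q y = x := by
        intro x
        apply (hexD n q x).1
        apply hE
        have h1 : (s : ℝ) ≤ q := by exact_mod_cast h
        push_cast [Nat.cast_sub hr]
        linarith
      choose sec hsec using hz
      exact ⟨sec, fun _ => hsec⟩
    · exact ⟨fun _ => 0, fun h' => absurd h' h⟩
  choose sec hsec using hsurj
  have hzero : ∀ x0 : D n s, (x0 : G n s) = 0 := by
    intro x0
    obtain ⟨y, hy0, hy⟩ := exists_seq_from (fun q => D n q) sec s x0
    obtain ⟨x, hx, hxs⟩ := extend_down (g n) s (fun q => (y q : G n q)) (by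
      intro q hq
      rw [← hgbar, hy q hq, hsec q hq])
    rw [← hy0, ← hxs s le_rfl]
    exact hlim n x hx s
  ext z
  exact hzero ⟨towerComp (g n) (r - 1) s z, by rw [hD]; exact ⟨z, rfl⟩⟩
end

section
/- Fix an integer r ≥ 1 and real numbers m and b with r < 1 − m. Suppose given: (i) for each integer n and each natural number q, an abelian group G_q^n with homomorphisms g : G_{q+1}^n → G_q^n, such that for each n the inverse limit of the tower (G_q^n, g) vanishes, i.e., any family of elements x_q ∈ G_q^n satisfying g(x_{q+1}) = x_q for all q must have every x_q = 0; (ii) for integers s ≥ 0 and t, set D^{s,t} := the image of the (r−1)-fold composite g^{r−1} : G_{s+r-1}^{t-s} → G_s^{t-s}, a subgroup of G_s^{t-s}, and note that g restricts to a homomorphism ḡ : D^{s+1,t+1} → D^{s,t}; (iii) abelian groups E^{s,t} with homomorphisms j : D^{s,t} → E^{s+r-1,t+r-1} and k : E^{s,t} → D^{s+1,t}, such that the long sequence ⋯ → E^{s,t+1} →(k) D^{s+1,t+1} →(ḡ) D^{s,t} →(j) E^{s+r-1,t+r-1} →(k) D^{s+r,t+r-1} → ⋯ is exact at every term. If E^{s,t}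 = 0 for all s, t with s ≥ m(t−s) + b, then the composite g^{r−1} : G_{s+r-1}^{t-s} → G_s^{t-s} is the zero homomorphism (equivalently D^{s,t} = 0) for all s, t with s + r − 1 ≥ m(t−s) + b. -/
/-- A compatible family defined from stage `s` on vanishes if the limit of the tower vanishes. -/
theorem partial_family_zero {G : ℕ → Type*} [∀ q, AddCommGroup (G q)]
    (g : ∀ q, G (q + 1) →+ G q)
    (hlim : ∀ x : ∀ q, G q, (∀ q, g q (x (q + 1)) = x q) → ∀ q, x q = 0) (s : ℕ) :
    ∀ y : ∀ q, s ≤ q → G q,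
      (∀ q (h : s ≤ q), g q (y (q + 1) (Nat.le_succ_of_le h)) = y q h) →
      ∀ q (h : s ≤ q), y q h = 0 := by
  induction s with
  | zero =>
    intro y hy q h
    exact hlim (fun q => y q (Nat.zero_le q)) (fun q => hy q (Nat.zero_le q)) q
  | succ s ih =>
    intro y hy q h
    have key := ih (fun q h => if h' : s + 1 ≤ q then y q h' else g q (y (q + 1) (by omega)))
      (by
        intro q hq
        have h1 : s + 1 ≤ q + 1 := by omega
        by_cases h' : s + 1 ≤ q
        · simp only [h1, h', dite_true]
          exact hy q h'
        · simp only [h1, h', dite_true, dite_false]) q (by omega)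
    simpa only [h, dite_true] using key

/-- Lemma 2(b), case `r < 1 - m`, of Hopkins–Palmieri–Smith.
Here `G n q = π_n(F_q X)` are the homotopy groups of the Adams tower
(with vanishing inverse limit, from `E`-completeness),
`D n s` is the image of `g^{r-1} : G n (s+r-1) → G n s` (indexed so that
`D n s = D_r^{s,t}` with `n = t - s`), `E n s = E_r^{s,t}`, and the long
sequence `⋯ → E^{s,t+1} → D^{s+1,t+1} → D^{s,t} → E^{s+r-1,t+r-1} → D^{s+r,t+r-1} → ⋯`
is exact.  If `E^{s,t} = 0` for `s ≥ m(t-s) + b`, then `g^{r-1}` is zero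
(i.e. `D^{s,t} = 0`) for `s + r - 1 ≥ m(t-s) + b`. -/
theorem vanishing_line_E_to_D_of_r_lt_one_sub_m
    (r : ℕ) (m b : ℝ) (hr : 1 ≤ r) (hrm : (r : ℝ) < 1 - m)
    (G : ℤ → ℕ → Type*) [∀ n q, AddCommGroup (G n q)]
    (g : ∀ n q, G n (q + 1) →+ G n q)
    (hlim : ∀ (n : ℤ) (x : ∀ q, G n q),
      (∀ q, g n q (x (q + 1)) = x q) → ∀ q, x q = 0)
    (D : ∀ (n : ℤ) (q : ℕ), AddSubgroup (G n q))
    (hD : ∀ n q, D n q = (towerComp (g n) (r - 1) q).range)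
    (E : ℤ → ℕ → Type*) [∀ n q, AddCommGroup (E n q)]
    (gbar : ∀ n q, D n (q + 1) →+ D n q)
    (hgbar : ∀ n q (x : D n (q + 1)), (gbar n q x : G n q) = g n q (x : G n (q + 1)))
    (j : ∀ n q, D n q →+ E n (q + (r - 1)))
    (k : ∀ n q, E (n + 1) q →+ D n (q + 1))
    (hexD' : ∀ n q, Function.Exact (k n q) (gbar n q))
    (hexD : ∀ n q, Function.Exact (gbar n q) (j n q))
    (hexE : ∀ n q, Function.Exact (j (n + 1) q) (k n (q + (r - 1))))
    (hE : ∀ (n : ℤ) (s : ℕ), (s : ℝ) ≥ m * n + b → ∀ x : E n s, x = 0) :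
    ∀ (n : ℤ) (s : ℕ), (s : ℝ) + r - 1 ≥ m * n + b →
      towerComp (g n) (r - 1) s = 0 := by
  intro n s hs
  have hsurj : ∀ q, s ≤ q → ∀ x : D n q, ∃ y : D n (q + 1), gbar n q y = x := by
    intro q hq x
    have hq' : (s : ℝ) ≤ q := by exact_mod_cast hq
    refine (hexD n q x).1 (hE n _ ?_ _)
    push_cast [Nat.cast_sub hr]
    linarith
  choose l hl using hsurj
  have hz : ∀ x : D n s, x = 0 := by
    intro x
    let y : ∀ q, s ≤ q → D n q := fun q h =>
      Nat.leRec (motive := fun q _ => D n q) x (fun q h z => l q h z) h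
    have hy : ∀ q (h : s ≤ q), gbar n q (y (q + 1) (Nat.le_succ_of_le h)) = y q h := by
      intro q h
      simp only [y]
      rw [Nat.leRec_succ _ _ h]
      exact hl q h _
    have h0 := partial_family_zero (g n) (hlim n) s (fun q h => (y q h : G n q))
      (fun q h => by rw [← hgbar, hy]) s le_rfl
    have hx : y s le_rfl = x := Nat.leRec_self _ _
    rw [← hx]
    exact Subtype.ext h0
  ext a
  have ha : towerComp (g n) (r - 1) s a ∈ D n s := by
    rw [hD]
    exact ⟨a, rfl⟩
  exact congrArg Subtype.val (hz ⟨_, ha⟩)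
end

section
/- Let (G_q)_{q ∈ ℕ} be a tower of abelian groups with homomorphisms g : G_{q+1} → G_q, and suppose its inverse limit vanishes: any family of elements x_q ∈ G_q satisfying g(x_{q+1}) = x_q for all q must have every x_q = 0. Fix an integer r ≥ 1 and a natural number s, and for each q let D_q denote the image of the (r−1)-fold composite g^{r−1} : G_{q+r-1} → G_q, a subgroup of G_q; the map g restricts to a homomorphism D_{q+1} → D_q. If for every q ≥ s the restricted map D_{q+1} → D_q is bijective, then D_s = 0; that is, the composite g^{r−1} : G_{s+r-1} → G_s is the zero homomorphism. -/
theorem tower_extend_down {G : ℕ → Type*} [∀ q, AddCommGroup (G q)]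
    (g : ∀ q, G (q + 1) →+ G q) (s : ℕ) :
    ∀ x : ∀ q, G q, (∀ q, s ≤ q → g q (x (q + 1)) = x q) →
      ∃ x' : ∀ q, G q, (∀ q, g q (x' (q + 1)) = x' q) ∧ x' s = x s := by
  induction s with
  | zero => exact fun x hx => ⟨x, fun q => hx q (Nat.zero_le q), rfl⟩
  | succ s ih =>
    intro x hx
    obtain ⟨x', h1, h2⟩ : ∃ x' : ∀ q, G q, (∀ q, s + 1 ≤ q → x' q = x q) ∧
        x' s = g s (x (s + 1)) :=
      ⟨Function.update x s (g s (x (s + 1))),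
        fun q hq => Function.update_of_ne (by omega) _ _, Function.update_self _ _ _⟩
    have key : ∀ q, s ≤ q → g q (x' (q + 1)) = x' q := by
      intro q hq
      rcases Nat.eq_or_lt_of_le hq with rfl | hq'
      · rw [h2, h1 _ le_rfl]
      · rw [h1 q hq', h1 (q + 1) (by omega), hx q hq']
    obtain ⟨x'', h3, h4⟩ := ih x' key
    refine ⟨fun q => if q ≤ s then x'' q else x' q, ?_, ?_⟩
    · intro q
      dsimp only
      by_cases hq : q + 1 ≤ s
      · rw [if_pos hq, if_pos (by omega), h3]
      · rw [if_neg hq]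
        by_cases hq' : q ≤ s
        · obtain rfl : q = s := by omega
          rw [if_pos hq', h4, key q le_rfl]
        · rw [if_neg hq', key q (by omega)]
    · simp [h1]

theorem tower_extend_up {G : ℕ → Type*} [∀ q, AddCommGroup (G q)]
    (g : ∀ q, G (q + 1) →+ G q) (D : ∀ q, Set (G q)) (s : ℕ)
    (hs : ∀ q, s ≤ q → ∀ y ∈ D q, ∃ z ∈ D (q + 1), g q z = y) (y : G s) (hy : y ∈ D s) :
    ∃ x : ∀ q, G q, (∀ q, s ≤ q → g q (x (q + 1)) = x q) ∧ x s = y := by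
  choose f hf hg using hs
  let F : ∀ q, s ≤ q → {z : G q // z ∈ D q} := fun q hq =>
    Nat.leRec (motive := fun q _ => {z : G q // z ∈ D q}) ⟨y, hy⟩
      (fun k hk z => ⟨f k hk z.1 z.2, hf k hk z.1 z.2⟩) hq
  refine ⟨fun q => if h : s ≤ q then (F q h).1 else 0, ?_, ?_⟩
  · intro q hq
    dsimp only
    rw [dif_pos hq, dif_pos (by omega : s ≤ q + 1)]
    simp only [F]
    rw [Nat.leRec_succ (h1 := hq)]
    exact hg _ _ _ _
  · simp [F, Nat.leRec_self]

/-- The convergence step in Lemma 2(b) of Hopkins–Palmieri–Smith: in a tower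
of abelian groups with vanishing inverse limit, if the maps induced by `g`
between the images `D_q` of the `(r-1)`-fold composites are bijective for all
`q ≥ s`, then `D_s = 0`, i.e. the composite `g^{r-1} : G_{s+r-1} → G_s` is zero. -/
theorem image_zero_of_bijOn_of_lim_vanishes
    (G : ℕ → Type*) [∀ q, AddCommGroup (G q)]
    (g : ∀ q, G (q + 1) →+ G q)
    (hlim : ∀ x : ∀ q, G q, (∀ q, g q (x (q + 1)) = x q) → ∀ q, x q = 0)
    (r : ℕ) (hr : 1 ≤ r) (s : ℕ)
    (hbij : ∀ q, s ≤ q →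
      Set.BijOn (g q) ((towerComp g (r - 1) (q + 1)).range : Set (G (q + 1)))
        ((towerComp g (r - 1) q).range : Set (G q))) :
    towerComp g (r - 1) s = 0 := by
  ext a
  obtain ⟨x, hx, hxs⟩ := tower_extend_up g
    (fun q => ((towerComp g (r - 1) q).range : Set (G q))) s
    (fun q hq y hy => (hbij q hq).surjOn hy) (towerComp g (r - 1) s a) ⟨a, rfl⟩
  obtain ⟨x', hx', hxs'⟩ := tower_extend_down g s x hx
  rw [← hxs, ← hxs', hlim x' hx' s]
  rfl
end

section
/- Fix integers r ≥ 1 and r' ≥ 1 and real numbers m, b, b'. Let (X_s^n), (Y_s^n), (Z_s^n) be towers of graded abelian groups: abelian groups indexed by s ∈ ℕ and n ∈ ℤ, with structure homomorphisms g : X_{s+1}^n → X_s^n (and similarly for Y and Z); write g^{k} for the k-fold composite. Suppose given homomorphisms f : X_s^n → Y_s^n and h : Y_s^n → Z_s^n for all s, n, each commuting with the structure maps g, such that for every s and n the sequence X_s^n → Y_s^n → Z_s^n is exact at Y_s^n (the image of f equals the kernel of h). Assume: (i) the composite g^{r−1} : X_{s+r-1}^n → X_s^n is the zero homomorphism whenever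 s ≥ mn + b; and (ii) the composite g^{r'−1} : Z_{s+r'-1}^n → Z_s^n is the zero homomorphism whenever s ≥ mn + b'. Then the composite g^{(r+r'−1)−1} : Y_{s+r+r'-2}^n → Y_s^n is the zero homomorphism whenever s ≥ mn + max(b, b' − r + 1). -/
theorem towerComp_heq_step {G : ℕ → Type*} [∀ q, AddCommGroup (G q)]
    (g : ∀ q, G (q + 1) →+ G q) (i j : ℕ) (e : i = j) (y : G (i + 1)) (z : G (j + 1))
    (hyz : HEq y z) : HEq (g i y) (g j z) := by
  subst e
  cases hyz
  rfl

theorem towerComp_add {G : ℕ → Type*} [∀ q, AddCommGroup (G q)]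
    (g : ∀ q, G (q + 1) →+ G q) (a q : ℕ) : ∀ (c : ℕ) (y : G (q + (a + c))) (z : G (q + a + c)),
    HEq y z → towerComp g (a + c) q y = towerComp g a q (towerComp g c (q + a) z)
  | 0, y, z, hyz => by
    cases hyz
    rfl
  | c + 1, y, z, hyz =>
    towerComp_add g a q c (g (q + (a + c)) y) (g (q + a + c) z)
      (towerComp_heq_step g _ _ (Nat.add_assoc q a c).symm y z hyz)

theorem towerComp_natural {G H : ℕ → Type*} [∀ q, AddCommGroup (G q)] [∀ q, AddCommGroup (H q)]
    (g : ∀ q, G (q + 1) →+ G q) (k : ∀ q, H (q + 1) →+ H q) (f : ∀ q, G q →+ H q)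
    (hf : ∀ q, (k q).comp (f (q + 1)) = (f q).comp (g q)) (q : ℕ) :
    ∀ (c : ℕ) (x : G (q + c)), towerComp k c q (f (q + c) x) = f q (towerComp g c q x)
  | 0, _ => rfl
  | c + 1, x => by
    have h1 : k (q + c) (f (q + c + 1) x) = f (q + c) (g (q + c) x) :=
      DFunLike.congr_fun (hf (q + c)) x
    have h2 := towerComp_natural g k f hf q c (g (q + c) x)
    rw [← h1] at h2
    exact h2

/-- The cofibration (two-out-of-three) half of the genericity argument in
Hopkins–Palmieri–Smith: given levelwise maps `f : X → Y`, `h : Y → Z` of towers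
of graded abelian groups, commuting with the structure maps and exact at `Y`,
if `X` satisfies the vanishing condition `(*)_{r,b}` and `Z` satisfies
`(*)_{r',b'}`, then `Y` satisfies `(*)_{r+r'-1, max(b, b'-r+1)}`. -/
theorem vanishing_line_two_of_three
    (r r' : ℕ) (hr : 1 ≤ r) (hr' : 1 ≤ r') (m b b' : ℝ)
    (X Y Z : ℕ → ℤ → Type*)
    [∀ s n, AddCommGroup (X s n)] [∀ s n, AddCommGroup (Y s n)]
    [∀ s n, AddCommGroup (Z s n)]
    (gX : ∀ s n, X (s + 1) n →+ X s n) (gY : ∀ s n, Y (s + 1) n →+ Y s n)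
    (gZ : ∀ s n, Z (s + 1) n →+ Z s n)
    (f : ∀ s n, X s n →+ Y s n) (h : ∀ s n, Y s n →+ Z s n)
    (hf : ∀ s n, (gY s n).comp (f (s + 1) n) = (f s n).comp (gX s n))
    (hh : ∀ s n, (gZ s n).comp (h (s + 1) n) = (h s n).comp (gY s n))
    (hexact : ∀ s n, Function.Exact (f s n) (h s n))
    (hX : ∀ (s : ℕ) (n : ℤ), (s : ℝ) ≥ m * n + b →
      towerComp (G := fun q => X q n) (fun q => gX q n) (r - 1) s = 0)
    (hZ : ∀ (s : ℕ) (n : ℤ), (s : ℝ) ≥ m * n + b' →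
      towerComp (G := fun q => Z q n) (fun q => gZ q n) (r' - 1) s = 0) :
    ∀ (s : ℕ) (n : ℤ), (s : ℝ) ≥ m * n + max b (b' - r + 1) →
      towerComp (G := fun q => Y q n) (fun q => gY q n) (r + r' - 2) s = 0 := by
  intro s n hs
  obtain ⟨a, rfl⟩ : ∃ a, r = a + 1 := ⟨r - 1, by omega⟩
  obtain ⟨c, rfl⟩ : ∃ c, r' = c + 1 := ⟨r' - 1, by omega⟩
  have e : a + 1 + (c + 1) - 2 = a + c := by omega
  rw [e]
  have hb := le_max_left b (b' - ((a + 1 : ℕ) : ℝ) + 1)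
  have hb' := le_max_right b (b' - ((a + 1 : ℕ) : ℝ) + 1)
  have hX' : towerComp (G := fun q => X q n) (fun q => gX q n) a s = 0 := hX s n (by linarith)
  have hZ' : towerComp (G := fun q => Z q n) (fun q => gZ q n) c (s + a) = 0 :=
    hZ (s + a) n (by push_cast at *; linarith)
  ext y
  have hty : Y (s + (a + c)) n = Y (s + a + c) n := by rw [Nat.add_assoc]
  rw [towerComp_add (G := fun q => Y q n) (fun q => gY q n) a s c y (cast hty y)
    (cast_heq hty y).symm]
  have hz := towerComp_natural (G := fun q => Y q n) (H := fun q => Z q n)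
    (fun q => gY q n) (fun q => gZ q n) (fun q => h q n) (fun q => hh q n) (s + a) c (cast hty y)
  rw [hZ'] at hz
  obtain ⟨x, hx⟩ := (hexact (s + a) n _).1 hz.symm
  have hx2 := towerComp_natural (G := fun q => X q n) (H := fun q => Y q n)
    (fun q => gX q n) (fun q => gY q n) (fun q => f q n) (fun q => hf q n) s a x
  rw [hX'] at hx2
  rw [← hx]
  exact hx2.trans (map_zero (f s n))
end
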